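/- Let 1 ≤ s ≤ r+1 ≤ n with n ≥ 2, p = r − s + 1, S' = K[x_1,…,x_r], S'' = K[x_s,…,x_n], S = K[x_1,…,x_n], and let I ⊂ S' and J ⊂ S'' be monomial ideals. Then sdepth_S(S/(IS + JS)) ≥ sdepth_{S'}(S'/I) + sdepth_{S''}(S''/J) − p = sdepth_S(S/IS) + sdepth_S(S/JS) − n. -/

import Mathlib

open MvPolynomial

/-- The `K`-subspace `m·K[Z]` of `S = K[x_0,…,x_{n-1}]`, where `m` is the monomial with
exponent vector `a` and `Z` is a set of variables: the span of all monomials `m·w`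
with `w` a monomial in the variables of `Z`. -/
noncomputable def StanleySpace (K : Type*) [Field K] {n : ℕ} (a : Fin n →₀ ℕ)
    (Z : Finset (Fin n)) : Submodule K (MvPolynomial (Fin n) K) :=
  Submodule.span K
    {p | ∃ c : Fin n →₀ ℕ, c.support ⊆ Z ∧ p = monomial (a + c) (1 : K)}

/-- `I` is a monomial ideal, i.e. an ideal generated by monomials. -/
def IsMonomialIdeal {K : Type*} [Field K] {n : ℕ}
    (I : Ideal (MvPolynomial (Fin n) K)) : Prop :=
  ∃ G : Set (Fin n →₀ ℕ), I = Ideal.span ((fun a => monomial a (1 : K)) '' G)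

/-- The `K`-subspace of `S` spanned by the monomials lying in `I` but not in `J`.
For monomial ideals `J ⊆ I` this is the canonical `K`-vector space representative
of the `ℤⁿ`-graded module `I/J` inside `S`. -/
noncomputable def monomialSpan (K : Type*) [Field K] {n : ℕ}
    (I J : Ideal (MvPolynomial (Fin n) K)) : Submodule K (MvPolynomial (Fin n) K) :=
  Submodule.span K
    {p | ∃ a : Fin n →₀ ℕ, p = monomial a (1 : K) ∧
      monomial a (1 : K) ∈ I ∧ monomial a (1 : K) ∉ J}

/-- The family `(a i, Z i), i = 1,…,r` is a Stanley decomposition of the module `I/J`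
(represented by the span of the monomials of `I \ J`): the Stanley spaces
`(a i)·K[Z i]` are independent and their (direct) sum is all of `I/J`. -/
def IsStanleyDecomp (K : Type*) [Field K] {n r : ℕ}
    (I J : Ideal (MvPolynomial (Fin n) K))
    (a : Fin r → (Fin n →₀ ℕ)) (Z : Fin r → Finset (Fin n)) : Prop :=
  iSupIndep (fun i => StanleySpace K (a i) (Z i)) ∧
    (⨆ i, StanleySpace K (a i) (Z i)) = monomialSpan K I J

/-- The Stanley depth `sdepth_S (I/J)` of the module `I/J`, where `J ⊆ I ⊆ S` are
monomial ideals: the largest `d` such that there is a Stanley decomposition of `I/J`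
all of whose Stanley spaces use at least `d` variables.  (As `ℕ∞`: the Stanley depth
of the zero module, which admits the empty decomposition, is `⊤`.)
`sdepth K I ⊥` is `sdepth_S I` and `sdepth K ⊤ I` is `sdepth_S (S/I)`. -/
noncomputable def sdepth (K : Type*) [Field K] {n : ℕ}
    (I J : Ideal (MvPolynomial (Fin n) K)) : ℕ∞ :=
  sSup {d : ℕ∞ | ∃ (r : ℕ) (a : Fin r → (Fin n →₀ ℕ)) (Z : Fin r → Finset (Fin n)),
    IsStanleyDecomp K I J a Z ∧ ∀ i, d ≤ ((Z i).card : ℕ∞)}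

/-- The depth `depth_S M` of an `S`-module `M` with respect to the maximal graded
ideal `(x_0,…,x_{n-1})`: the supremum of the lengths of `M`-regular sequences
contained in that ideal. -/
noncomputable def gradedDepth (K : Type*) [Field K] (n : ℕ) (M : Type*)
    [AddCommGroup M] [Module (MvPolynomial (Fin n) K) M] : ℕ∞ :=
  sSup {k : ℕ∞ | ∃ rs : List (MvPolynomial (Fin n) K), (rs.length : ℕ∞) = k ∧
    (∀ x ∈ rs, x ∈ Ideal.span (Set.range (X : Fin n → MvPolynomial (Fin n) K))) ∧
    RingTheory.Sequence.IsRegular M rs}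

/-- Extension of an ideal along an inclusion of polynomial rings induced by a map
of variables (`IS`, for `f` injective). -/
noncomputable def extIdeal {K : Type*} [Field K] {m n : ℕ} (f : Fin m → Fin n)
    (I : Ideal (MvPolynomial (Fin m) K)) : Ideal (MvPolynomial (Fin n) K) :=
  Ideal.map (rename f : MvPolynomial (Fin m) K →ₐ[K] MvPolynomial (Fin n) K) I

/-- The inclusion of the variables of `S'' = K[x_{r+1},…,x_n]` into those of
`S = K[x_1,…,x_n]` (variables indexed from `0`). -/
def sndEmbed {n r : ℕ} (h : r ≤ n) : Fin (n - r) → Fin n :=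
  fun i => ⟨r + i.1, by have := i.2; omega⟩

/-- The inclusion of the variables of `S'' = K[x_s,…,x_n]` into those of
`S = K[x_1,…,x_n]` (variables indexed from `0`). -/
def midEmbed {n s : ℕ} (hs : 1 ≤ s) (hsn : s ≤ n) : Fin (n + 1 - s) → Fin n :=
  fun i => ⟨s - 1 + i.1, by have := i.2; omega⟩

/-- The exponent vectors of the monomials in the Stanley space `m·K[Z]`. -/
def stanleyBox {n : ℕ} (a : Fin n →₀ ℕ) (Z : Finset (Fin n)) : Set (Fin n →₀ ℕ) :=
  {c | a ≤ c ∧ ∀ k ∉ Z, c k = a k}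

/-- The set `D` of exponent vectors is a finite disjoint union of boxes, each of which has at
least `d` free directions. -/
def HasBoxPartition {n : ℕ} (D : Set (Fin n →₀ ℕ)) (d : ℕ∞) : Prop :=
  ∃ (ι : Type) (_ : Finite ι) (a : ι → (Fin n →₀ ℕ)) (Z : ι → Finset (Fin n)),
    Pairwise (fun i j => Disjoint (stanleyBox (a i) (Z i)) (stanleyBox (a j) (Z j))) ∧
      (⋃ i, stanleyBox (a i) (Z i)) = D ∧ ∀ i, d ≤ ((Z i).card : ℕ∞)

/-- The exponent vectors of the monomials outside `I`. -/
def standardExponents {K : Type*} [Field K] {n : ℕ} (I : Ideal (MvPolynomial (Fin n) K)) :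
    Set (Fin n →₀ ℕ) :=
  {c | monomial c (1 : K) ∉ I}

section SpanOfMonomials

variable (K : Type*) [Field K] {n : ℕ}

theorem linearIndependent_monomial_one :
    LinearIndependent K (fun c : Fin n →₀ ℕ => monomial c (1 : K)) := by
  rw [← coe_basisMonomials]
  exact (basisMonomials (Fin n) K).linearIndependent

theorem stanleySpace_eq_span_image (a : Fin n →₀ ℕ) (Z : Finset (Fin n)) :
    StanleySpace K a Z =
      Submodule.span K ((fun c : Fin n →₀ ℕ => monomial c (1 : K)) '' stanleyBox a Z) := by
  unfold StanleySpace
  congr 1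
  ext p
  constructor
  · rintro ⟨c, hc, rfl⟩
    refine ⟨a + c, ⟨le_self_add, fun k hk => ?_⟩, rfl⟩
    have : c k = 0 := by
      by_contra h
      exact hk (hc (Finsupp.mem_support_iff.2 h))
    simp [this]
  · rintro ⟨c, ⟨hac, hc⟩, rfl⟩
    refine ⟨c - a, fun k hk => ?_, by rw [add_tsub_cancel_of_le hac]⟩
    by_contra h
    simp [hc k h] at hk

theorem monomialSpan_top_eq_span_image (I : Ideal (MvPolynomial (Fin n) K)) :
    monomialSpan K ⊤ I =
      Submodule.span K ((fun c : Fin n →₀ ℕ => monomial c (1 : K)) '' standardExponents I) := by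
  unfold monomialSpan
  congr 1
  ext p
  constructor
  · rintro ⟨c, rfl, -, hc⟩
    exact ⟨c, hc, rfl⟩
  · rintro ⟨c, hc, rfl⟩
    exact ⟨c, rfl, Submodule.mem_top, hc⟩

theorem span_monomial_image_injective :
    Function.Injective (fun D : Set (Fin n →₀ ℕ) =>
      Submodule.span K ((fun c : Fin n →₀ ℕ => monomial c (1 : K)) '' D)) := by
  have key : ∀ D E : Set (Fin n →₀ ℕ),
      Submodule.span K ((fun c : Fin n →₀ ℕ => monomial c (1 : K)) '' D) ≤
        Submodule.span K ((fun c : Fin n →₀ ℕ => monomial c (1 : K)) '' E) → D ⊆ E := by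
    intro D E h c hc
    by_contra hcE
    exact (linearIndependent_monomial_one K).notMem_span_image hcE
      (h (Submodule.subset_span ⟨c, hc, rfl⟩))
  intro D E h
  exact (key D E h.le).antisymm (key E D h.ge)

theorem iSup_span_monomial_image {ι : Sort*} (D : ι → Set (Fin n →₀ ℕ)) :
    (⨆ i, Submodule.span K ((fun c : Fin n →₀ ℕ => monomial c (1 : K)) '' D i)) =
      Submodule.span K ((fun c : Fin n →₀ ℕ => monomial c (1 : K)) '' ⋃ i, D i) := by
  rw [Set.image_iUnion, Submodule.span_iUnion]

theorem iSupIndep_span_monomial_image {ι : Type*} (D : ι → Set (Fin n →₀ ℕ)) :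
    iSupIndep (fun i => Submodule.span K ((fun c : Fin n →₀ ℕ => monomial c (1 : K)) '' D i)) ↔
      Pairwise (fun i j => Disjoint (D i) (D j)) := by
  constructor
  · intro h i j hij
    rw [Set.disjoint_left]
    intro c hi hj
    exact (linearIndependent_monomial_one K).ne_zero c
      (Submodule.disjoint_def.1 (h.pairwiseDisjoint hij) _ (Submodule.subset_span ⟨c, hi, rfl⟩)
        (Submodule.subset_span ⟨c, hj, rfl⟩))
  · intro h i
    simp_rw [iSup_span_monomial_image]
    refine (linearIndependent_monomial_one K).disjoint_span_image ?_
    simp only [Set.disjoint_iUnion_right]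
    exact fun j hj => h hj.symm

theorem isStanleyDecomp_top_iff {r : ℕ} (I : Ideal (MvPolynomial (Fin n) K))
    (a : Fin r → (Fin n →₀ ℕ)) (Z : Fin r → Finset (Fin n)) :
    IsStanleyDecomp K ⊤ I a Z ↔
      Pairwise (fun i j => Disjoint (stanleyBox (a i) (Z i)) (stanleyBox (a j) (Z j))) ∧
        (⋃ i, stanleyBox (a i) (Z i)) = standardExponents I := by
  simp only [IsStanleyDecomp, stanleySpace_eq_span_image, monomialSpan_top_eq_span_image,
    iSupIndep_span_monomial_image, iSup_span_monomial_image]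
  exact and_congr_right fun _ => (span_monomial_image_injective K).eq_iff

theorem sdepth_top_eq_sSup (I : Ideal (MvPolynomial (Fin n) K)) :
    sdepth K ⊤ I = sSup {d | HasBoxPartition (standardExponents I) d} := by
  unfold sdepth
  congr 1
  ext d
  simp only [Set.mem_ofPred_eq, isStanleyDecomp_top_iff]
  constructor
  · rintro ⟨r, a, Z, ⟨hdisj, hunion⟩, hd⟩
    exact ⟨Fin r, inferInstance, a, Z, hdisj, hunion, hd⟩
  · rintro ⟨ι, _, a, Z, hdisj, hunion, hd⟩
    let e := (Finite.equivFin ι).symm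
    refine ⟨Nat.card ι, a ∘ e, Z ∘ e, ⟨fun i j hij => hdisj (e.injective.ne hij), ?_⟩,
      fun i => hd (e i)⟩
    rw [← hunion]
    exact e.surjective.iUnion_comp fun i => stanleyBox (a i) (Z i)

end SpanOfMonomials

section Boxes

variable {m n : ℕ}

theorem stanleyBox_inter {a b c₀ : Fin n →₀ ℕ} {Z W : Finset (Fin n)}
    (ha : c₀ ∈ stanleyBox a Z) (hb : c₀ ∈ stanleyBox b W) :
    stanleyBox a Z ∩ stanleyBox b W = stanleyBox (a ⊔ b) (Z ∩ W) := by
  ext c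
  simp only [stanleyBox, Set.mem_inter_iff, Set.mem_ofPred_eq, Finset.mem_inter, not_and_or,
    Finsupp.le_def, Finsupp.sup_apply] at *
  obtain ⟨ha, ha'⟩ := ha
  obtain ⟨hb, hb'⟩ := hb
  rw [← forall_and, ← forall_and, ← forall_and, ← forall_and] at *
  refine forall_congr' fun k => ?_
  have h₁ := ha k
  have h₂ := ha' k
  have h₃ := hb k
  have h₄ := hb' k
  by_cases hZ : k ∈ Z <;> by_cases hW : k ∈ W <;> simp [hZ, hW] at * <;> omega

theorem HasBoxPartition.inter {D E : Set (Fin n →₀ ℕ)} {d e : ℕ∞}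
    (hD : HasBoxPartition D d) (hE : HasBoxPartition E e) :
    HasBoxPartition (D ∩ E) (d + e - n) := by
  obtain ⟨ι, _, a, Z, hdisj, rfl, hd⟩ := hD
  obtain ⟨κ, _, b, W, hdisj', rfl, he⟩ := hE
  let τ := {q : ι × κ // (stanleyBox (a q.1) (Z q.1) ∩ stanleyBox (b q.2) (W q.2)).Nonempty}
  have hbox (q : τ) := stanleyBox_inter q.2.some_mem.1 q.2.some_mem.2
  refine ⟨τ, inferInstance, fun q => a q.1.1 ⊔ b q.1.2, fun q => Z q.1.1 ∩ W q.1.2, ?_, ?_, ?_⟩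
  · intro p q hpq
    rw [← hbox, ← hbox]
    by_cases h : p.1.1 = q.1.1
    · have h' : p.1.2 ≠ q.1.2 := fun h' => hpq (Subtype.ext (Prod.ext h h'))
      exact (hdisj' h').mono Set.inter_subset_right Set.inter_subset_right
    · exact (hdisj h).mono Set.inter_subset_left Set.inter_subset_left
  · simp_rw [← hbox]
    ext c
    simp only [Set.mem_iUnion, Set.mem_inter_iff]
    constructor
    · rintro ⟨q, h₁, h₂⟩
      exact ⟨⟨_, h₁⟩, ⟨_, h₂⟩⟩
    · rintro ⟨⟨i, h₁⟩, ⟨j, h₂⟩⟩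
      exact ⟨⟨(i, j), c, h₁, h₂⟩, h₁, h₂⟩
  · intro q
    rw [tsub_le_iff_right]
    refine (add_le_add (hd q.1.1) (he q.1.2)).trans ?_
    have h₁ := Finset.card_union_add_card_inter (Z q.1.1) (W q.1.2)
    have h₂ := (Z q.1.1 ∪ W q.1.2).card_le_univ
    rw [Fintype.card_fin] at h₂
    norm_cast
    change (Z q.1.1).card + (W q.1.2).card ≤ (Z q.1.1 ∩ W q.1.2).card + n
    omega

theorem HasBoxPartition.comapDomain {f : Fin m → Fin n} (hf : f.Injective)
    {D : Set (Fin m →₀ ℕ)} {d : ℕ∞} (hD : HasBoxPartition D d) :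
    HasBoxPartition {c | c.comapDomain f hf.injOn ∈ D} (d + (n - m : ℕ)) := by
  classical
  obtain ⟨ι, _, a, Z, hdisj, rfl, hd⟩ := hD
  have hbox (i : ι) : stanleyBox ((a i).mapDomain f)
      ((Z i).map ⟨f, hf⟩ ∪ (Finset.univ.map ⟨f, hf⟩)ᶜ) =
        {c | c.comapDomain f hf.injOn ∈ stanleyBox (a i) (Z i)} := by
    ext c
    simp only [stanleyBox, Set.mem_ofPred_eq, Finsupp.le_def, Finsupp.comapDomain_apply]
    constructor
    · rintro ⟨h₁, h₂⟩
      refine ⟨fun k => ?_, fun k hk => ?_⟩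
      · simpa [Finsupp.mapDomain_apply hf] using h₁ (f k)
      · simpa [Finsupp.mapDomain_apply hf, hf.eq_iff, hk] using h₂ (f k)
    · rintro ⟨h₁, h₂⟩
      refine ⟨fun k => ?_, fun k hk => ?_⟩
      · by_cases hk : k ∈ Set.range f
        · obtain ⟨k, rfl⟩ := hk
          simpa [Finsupp.mapDomain_apply hf] using h₁ k
        · simp [Finsupp.mapDomain_of_notMem_range _ _ hk]
      · obtain ⟨k, rfl⟩ : ∃ j, f j = k := by
          by_contra h
          exact hk (by simpa using Or.inr h)
        rw [Finsupp.mapDomain_apply hf]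
        refine h₂ k fun h => hk ?_
        simp [h]
  refine ⟨ι, inferInstance, _, _, ?_, (Set.iUnion_congr hbox).trans ?_, fun i => ?_⟩
  · intro i j hij
    rw [hbox, hbox]
    exact (hdisj hij).preimage _
  · ext c
    simp
  · rw [Finset.card_union_of_disjoint, Finset.card_compl]
    · simpa using hd i
    · rw [disjoint_compl_right_iff]
      exact Finset.map_subset_map.2 (Finset.subset_univ _)

theorem HasBoxPartition.mapDomain {f : Fin m → Fin n} (hf : f.Injective)
    {D : Set (Fin n →₀ ℕ)} {d : ℕ∞} (hD : HasBoxPartition D d) :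
    HasBoxPartition {c | c.mapDomain f ∈ D} (d - (n - m : ℕ)) := by
  classical
  obtain ⟨ι, _, a, Z, hdisj, rfl, hd⟩ := hD
  let τ := {i : ι // ∀ k ∉ Set.range f, a i k = 0}
  have hbox (i : τ) : stanleyBox ((a i).comapDomain f hf.injOn)
      ((Z i).preimage f hf.injOn) = {c | c.mapDomain f ∈ stanleyBox (a i) (Z i)} := by
    ext c
    simp only [stanleyBox, Set.mem_ofPred_eq, Finsupp.le_def, Finsupp.comapDomain_apply,
      Finset.mem_preimage]
    constructor
    · rintro ⟨h₁, h₂⟩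
      refine ⟨fun k => ?_, fun k hk => ?_⟩ <;> by_cases hkf : k ∈ Set.range f
      · obtain ⟨k, rfl⟩ := hkf
        simpa [Finsupp.mapDomain_apply hf] using h₁ k
      · simp [i.2 k hkf]
      · obtain ⟨k, rfl⟩ := hkf
        simpa [Finsupp.mapDomain_apply hf] using h₂ k hk
      · rw [i.2 k hkf, Finsupp.mapDomain_of_notMem_range _ _ hkf]
    · rintro ⟨h₁, h₂⟩
      refine ⟨fun k => ?_, fun k hk => ?_⟩
      · simpa [Finsupp.mapDomain_apply hf] using h₁ (f k)
      · simpa [Finsupp.mapDomain_apply hf] using h₂ (f k) hk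
  refine ⟨τ, inferInstance, _, _, ?_, (Set.iUnion_congr hbox).trans ?_, fun i => ?_⟩
  · intro i j hij
    rw [hbox, hbox]
    exact (hdisj (Subtype.coe_injective.ne hij)).preimage _
  · ext c
    simp only [Set.mem_iUnion, Set.mem_ofPred_eq]
    refine ⟨fun ⟨i, hi⟩ => ⟨i, hi⟩, fun ⟨i, hi⟩ => ⟨⟨i, fun k hk => ?_⟩, hi⟩⟩
    have := hi.1 k
    rwa [Finsupp.mapDomain_of_notMem_range _ _ hk, Nat.le_zero] at this
  · rw [tsub_le_iff_right]
    refine (hd i).trans ?_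
    have h₁ : Z i ⊆ ((Z i).preimage f hf.injOn).map ⟨f, hf⟩ ∪ (Finset.univ.map ⟨f, hf⟩)ᶜ := by
      intro k hk
      by_cases hkf : k ∈ Set.range f
      · obtain ⟨k, rfl⟩ := hkf
        simp [hk]
      · simpa using Or.inr fun j hj => hkf ⟨j, hj⟩
    have h₂ := (Finset.card_le_card h₁).trans (Finset.card_union_le _ _)
    rw [Finset.card_compl] at h₂
    simp only [Finset.card_map, Finset.card_univ, Fintype.card_fin] at h₂
    exact_mod_cast h₂

end Boxes

section MonomialIdeals

variable {K : Type*} [Field K] {m n : ℕ}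

theorem mem_standardExponents_span {G : Set (Fin n →₀ ℕ)} {c : Fin n →₀ ℕ} :
    c ∈ standardExponents (Ideal.span ((fun a => monomial a (1 : K)) '' G)) ↔
      ∀ g ∈ G, ¬ g ≤ c := by
  classical
  simp [standardExponents, mem_ideal_span_monomial_image, support_monomial]

theorem IsMonomialIdeal.exists_finset {I : Ideal (MvPolynomial (Fin n) K)}
    (hI : IsMonomialIdeal I) :
    ∃ G : Finset (Fin n →₀ ℕ), I = Ideal.span ((fun a => monomial a (1 : K)) '' G) := by
  classical
  obtain ⟨G, rfl⟩ := hI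
  obtain ⟨T, hT, hspan⟩ := (Submodule.fg_span_iff_fg_span_finset_subset _).1
    (IsNoetherian.noetherian (Ideal.span ((fun a => monomial a (1 : K)) '' G)))
  obtain ⟨H, -, rfl⟩ := Finset.subset_set_image_iff.1 hT
  exact ⟨H, by simpa [Ideal.span] using hspan⟩

/-- Truncating exponents at a bound for the generators gives a partition of the standard
monomials. -/
theorem IsMonomialIdeal.hasBoxPartition_zero {I : Ideal (MvPolynomial (Fin n) K)}
    (hI : IsMonomialIdeal I) : HasBoxPartition (standardExponents I) 0 := by
  classical
  obtain ⟨G, rfl⟩ := hI.exists_finset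
  let N : Fin n →₀ ℕ := G.sup id
  have hN : ∀ g ∈ G, g ≤ N := fun g hg => Finset.le_sup (f := id) hg
  let τ := {a : Fin n →₀ ℕ // a ∈ Finset.Iic N ∧
    a ∈ standardExponents (Ideal.span ((fun a => monomial a (1 : K)) '' G))}
  have hτ : Finite τ := Finite.of_injective
    (fun a : τ => (⟨a.1, a.2.1⟩ : {a // a ∈ Finset.Iic N}))
    fun _ _ h => Subtype.ext (Subtype.mk.inj h)
  have hbox (a c : Fin n →₀ ℕ) (ha : a ≤ N) :
      c ∈ stanleyBox a {k | a k = N k} ↔ c ⊓ N = a := by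
    simp only [stanleyBox, Set.mem_ofPred_eq, Finsupp.le_def, Finset.mem_filter, Finset.mem_univ,
      true_and, Finsupp.ext_iff, Finsupp.inf_apply, ← forall_and]
    refine forall_congr' fun k => ?_
    have := ha k
    omega
  refine ⟨τ, hτ, fun a => a.1, fun a => {k | a.1 k = N k}, ?_, ?_, fun _ => zero_le⟩
  · intro a b hab
    rw [Set.disjoint_left]
    intro c hca hcb
    rw [hbox _ _ (Finset.mem_Iic.1 a.2.1)] at hca
    rw [hbox _ _ (Finset.mem_Iic.1 b.2.1)] at hcb
    exact hab (Subtype.ext (hca.symm.trans hcb))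
  · ext c
    have hc : c ⊓ N ∈ standardExponents (Ideal.span ((fun a => monomial a (1 : K)) '' G)) ↔
        c ∈ standardExponents (Ideal.span ((fun a => monomial a (1 : K)) '' G)) := by
      simp only [mem_standardExponents_span, le_inf_iff]
      exact forall₂_congr fun g hg => not_congr (and_iff_left (hN g hg))
    rw [← hc, Set.mem_iUnion]
    constructor
    · rintro ⟨a, ha⟩
      rw [(hbox _ _ (Finset.mem_Iic.1 a.2.1)).1 ha]
      exact a.2.2
    · intro h
      exact ⟨⟨c ⊓ N, Finset.mem_Iic.2 inf_le_right, h⟩, (hbox _ _ inf_le_right).2 rfl⟩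

theorem extIdeal_span_monomial (f : Fin m → Fin n) (G : Set (Fin m →₀ ℕ)) :
    extIdeal f (Ideal.span ((fun a => monomial a (1 : K)) '' G)) =
      Ideal.span ((fun a => monomial a (1 : K)) '' (Finsupp.mapDomain f '' G)) := by
  rw [extIdeal, Ideal.map_span, Set.image_image, Set.image_image]
  simp [rename_monomial]

theorem IsMonomialIdeal.extIdeal {I : Ideal (MvPolynomial (Fin m) K)} (hI : IsMonomialIdeal I)
    (f : Fin m → Fin n) : IsMonomialIdeal (extIdeal f I) := by
  obtain ⟨G, rfl⟩ := hI
  exact ⟨_, extIdeal_span_monomial f G⟩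

theorem standardExponents_extIdeal {I : Ideal (MvPolynomial (Fin m) K)}
    (hI : IsMonomialIdeal I) {f : Fin m → Fin n} (hf : f.Injective) :
    standardExponents (_root_.extIdeal f I) =
      {c | c.comapDomain f hf.injOn ∈ standardExponents I} := by
  obtain ⟨G, rfl⟩ := hI
  ext c
  rw [extIdeal_span_monomial, Set.mem_ofPred_eq, mem_standardExponents_span,
    mem_standardExponents_span, Set.forall_mem_image]
  refine forall₂_congr fun g _ => not_congr ⟨fun h k => ?_, fun h k => ?_⟩
  · simpa [Finsupp.mapDomain_apply hf] using h (f k)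
  · by_cases hk : k ∈ Set.range f
    · obtain ⟨k, rfl⟩ := hk
      simpa [Finsupp.mapDomain_apply hf] using h k
    · simp [Finsupp.mapDomain_of_notMem_range _ _ hk]

theorem standardExponents_sup {I J : Ideal (MvPolynomial (Fin n) K)}
    (hI : IsMonomialIdeal I) (hJ : IsMonomialIdeal J) :
    standardExponents (I ⊔ J) = standardExponents I ∩ standardExponents J := by
  obtain ⟨G, rfl⟩ := hI
  obtain ⟨H, rfl⟩ := hJ
  ext c
  rw [← Ideal.span_union, ← Set.image_union, Set.mem_inter_iff]
  simp only [mem_standardExponents_span, Set.mem_union, or_imp, forall_and]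

/-- Each extra variable raises the Stanley depth of a quotient by one. -/
theorem sdepth_top_extIdeal {I : Ideal (MvPolynomial (Fin m) K)}
    (hI : IsMonomialIdeal I) {f : Fin m → Fin n} (hf : f.Injective) :
    sdepth K ⊤ (_root_.extIdeal f I) = sdepth K ⊤ I + (n - m : ℕ) := by
  simp only [sdepth_top_eq_sSup]
  apply le_antisymm
  · refine sSup_le fun d hd => ?_
    rw [← tsub_le_iff_right]
    apply le_sSup
    have := HasBoxPartition.mapDomain hf hd
    simpa only [standardExponents_extIdeal hI hf, Set.mem_ofPred_eq,
      Finsupp.comapDomain_mapDomain f hf, Set.ofPred_mem_eq] using this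
  · rw [ENat.sSup_add ⟨0, hI.hasBoxPartition_zero⟩]
    refine iSup₂_le fun d hd => le_sSup ?_
    rw [Set.mem_ofPred_eq, standardExponents_extIdeal hI hf]
    exact HasBoxPartition.comapDomain hf hd

theorem sdepth_add_sdepth_le_sdepth_sup_add {I J : Ideal (MvPolynomial (Fin n) K)}
    (hI : IsMonomialIdeal I) (hJ : IsMonomialIdeal J) :
    sdepth K ⊤ I + sdepth K ⊤ J ≤ sdepth K ⊤ (I ⊔ J) + n := by
  simp only [sdepth_top_eq_sSup, standardExponents_sup hI hJ]
  rw [sSup_eq_iSup, sSup_eq_iSup (s := {d | HasBoxPartition (standardExponents J) d})]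
  refine ENat.biSup_add_biSup_le ⟨0, hI.hasBoxPartition_zero⟩ ⟨0, hJ.hasBoxPartition_zero⟩
    fun d hd e he => ?_
  rw [← tsub_le_iff_right]
  exact le_sSup (HasBoxPartition.inter hd he)

end MonomialIdeals

/-- Let `1 ≤ s ≤ r+1 ≤ n`, `n ≥ 2`, `p = r - s + 1`,
`S' = K[x_1,…,x_r]`, `S'' = K[x_s,…,x_n]`, and `I ⊂ S'`, `J ⊂ S''` monomial ideals.
Then `sdepth_S(S/(IS + JS)) ≥ sdepth_{S'}(S'/I) + sdepth_{S''}(S''/J) - p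
= sdepth_S(S/IS) + sdepth_S(S/JS) - n`. -/
theorem sdepth_quot_sup_general {K : Type*} [Field K] {n r s : ℕ}
    (hs : 1 ≤ s) (hsr : s ≤ r + 1) (hrn : r + 1 ≤ n) (hn : 2 ≤ n)
    (I : Ideal (MvPolynomial (Fin r) K)) (J : Ideal (MvPolynomial (Fin (n + 1 - s)) K))
    (hmI : IsMonomialIdeal I) (hmJ : IsMonomialIdeal J)
    (hI0 : I ≠ ⊥) (hI1 : I ≠ ⊤) (hJ0 : J ≠ ⊥) (hJ1 : J ≠ ⊤) :
    sdepth K ⊤ (extIdeal (Fin.castLE (by omega : r ≤ n)) I ⊔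
        extIdeal (midEmbed hs (by omega : s ≤ n)) J) ≥
      sdepth K ⊤ I + sdepth K ⊤ J - ((r + 1 - s : ℕ) : ℕ∞) ∧
    sdepth K ⊤ I + sdepth K ⊤ J - ((r + 1 - s : ℕ) : ℕ∞) =
      sdepth K ⊤ (extIdeal (Fin.castLE (by omega : r ≤ n)) I) +
        sdepth K ⊤ (extIdeal (midEmbed hs (by omega : s ≤ n)) J) - (n : ℕ∞) := by
  have hr : (Fin.castLE (by omega : r ≤ n)).Injective := Fin.castLE_injective _
  have hm : (midEmbed hs (by omega : s ≤ n)).Injective := by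
    intro i j hij
    simp only [midEmbed, Fin.mk.injEq] at hij
    omega
  have heq : sdepth K ⊤ I + sdepth K ⊤ J - ((r + 1 - s : ℕ) : ℕ∞) =
      sdepth K ⊤ (extIdeal (Fin.castLE (by omega : r ≤ n)) I) +
        sdepth K ⊤ (extIdeal (midEmbed hs (by omega : s ≤ n)) J) - (n : ℕ∞) := by
    rw [sdepth_top_extIdeal hmI hr, sdepth_top_extIdeal hmJ hm, add_add_add_comm]
    have hcast : (n : ℕ∞) =
        ((r + 1 - s : ℕ) : ℕ∞) + (((n - r : ℕ) : ℕ∞) + ((n - (n + 1 - s) : ℕ) : ℕ∞)) := by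
      norm_cast
      omega
    rw [hcast, tsub_add_eq_tsub_tsub_swap, ← Nat.cast_add,
      (ENat.addLECancellable_natCast _).add_tsub_cancel_right]
  refine ⟨?_, heq⟩
  rw [ge_iff_le, heq, tsub_le_iff_right]
  exact sdepth_add_sdepth_le_sdepth_sup_add (hmI.extIdeal _) (hmJ.extIdeal _)
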